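/- arXiv:1307.0423 — 3 statements merged into one kernel-verified Lean document; each statement's English description precedes it below -/
import Mathlib

section
/- Let T > 0 and let d : ℝ → ℝ be differentiable on [0,T) with d'(t) ≥ −2·tanh(d(t)/2) for every t ∈ [0,T). Then for every t ∈ [0,T) one has e^t · sinh(d(t)/2) ≥ sinh(d(0)/2). -/
open Real

/-- Analytic core of the comparison principle for MCF in hyperbolic space:
if `d` is differentiable on `[0,T)` with `d'(t) ≥ -2 tanh(d(t)/2)`, then
`e^t sinh(d(t)/2) ≥ sinh(d(0)/2)` on `[0,T)`. -/
theorem stmt_0 (T : ℝ) (hT : 0 < T) (d d' : ℝ → ℝ)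
    (hderiv : ∀ t ∈ Set.Ico (0 : ℝ) T, HasDerivAt d (d' t) t)
    (hineq : ∀ t ∈ Set.Ico (0 : ℝ) T, d' t ≥ -2 * Real.tanh (d t / 2)) :
    ∀ t ∈ Set.Ico (0 : ℝ) T,
      Real.exp t * Real.sinh (d t / 2) ≥ Real.sinh (d 0 / 2) := by
  have hasDeriv : ∀ t ∈ Set.Ico (0 : ℝ) T,
      HasDerivAt (fun s => Real.exp s * Real.sinh (d s / 2))
        (Real.exp t * Real.sinh (d t / 2)
          + Real.exp t * (Real.cosh (d t / 2) * (d' t / 2))) t := fun t ht =>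
    (Real.hasDerivAt_exp t).mul ((hderiv t ht).div_const 2).sinh
  have hmono : MonotoneOn (fun s => Real.exp s * Real.sinh (d s / 2)) (Set.Ico 0 T) := by
    refine monotoneOn_of_deriv_nonneg (convex_Ico 0 T)
      (fun t ht => (hasDeriv t ht).continuousAt.continuousWithinAt)
      (fun t ht => (hasDeriv t (interior_subset ht)).differentiableAt.differentiableWithinAt)
      fun t ht => ?_
    have ht' := interior_subset ht
    rw [(hasDeriv t ht').deriv, ← mul_add]
    refine mul_nonneg (Real.exp_pos t).le ?_
    have hcosh := Real.cosh_pos (d t / 2)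
    have htanh : Real.cosh (d t / 2) * Real.tanh (d t / 2) = Real.sinh (d t / 2) := by
      rw [Real.tanh_eq_sinh_div_cosh, mul_div_cancel₀ _ hcosh.ne']
    have := mul_le_mul_of_nonneg_left (hineq t ht') hcosh.le
    linarith
  intro t ht
  simpa using hmono (Set.left_mem_Ico.2 hT) ht ht.1
end

section
/- Fix d > 0 and define f : ℝ → ℝ by f(s) = cosh(s) − tanh(d/2)·sinh(s). Then ∫₀^d (f'(s)² + f(s)²) ds = 2·tanh(d/2). -/
theorem cosh_sub_tanh_half_mul_sinh (d : ℝ) :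
    Real.cosh d - Real.tanh (d / 2) * Real.sinh d = 1 := by
  obtain ⟨a, rfl⟩ : ∃ a, d = 2 * a := ⟨d / 2, by ring⟩
  have hc := (Real.cosh_pos a).ne'
  rw [mul_div_cancel_left₀ a two_ne_zero, Real.tanh_eq_sinh_div_cosh, Real.cosh_two_mul,
    Real.sinh_two_mul]
  field_simp
  linear_combination Real.cosh_sq a

theorem sinh_sub_tanh_half_mul_cosh (d : ℝ) :
    Real.sinh d - Real.tanh (d / 2) * Real.cosh d = Real.tanh (d / 2) := by
  obtain ⟨a, rfl⟩ : ∃ a, d = 2 * a := ⟨d / 2, by ring⟩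
  have hc := (Real.cosh_pos a).ne'
  rw [mul_div_cancel_left₀ a two_ne_zero, Real.tanh_eq_sinh_div_cosh, Real.cosh_two_mul,
    Real.sinh_two_mul]
  field_simp
  linear_combination Real.sinh a * Real.cosh_sq a

/-- For `f(s) = cosh s - tanh(d/2) sinh s` one has `∫₀^d (f'² + f²) = 2 tanh(d/2)`. -/
theorem stmt_4 (d : ℝ) (hd : 0 < d)
    (f : ℝ → ℝ) (hf : f = fun s => Real.cosh s - Real.tanh (d / 2) * Real.sinh s) :
    ∫ s in (0 : ℝ)..d, ((deriv f s) ^ 2 + (f s) ^ 2) = 2 * Real.tanh (d / 2) := by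
  set t := Real.tanh (d / 2) with ht
  have hf' (s : ℝ) : HasDerivAt f (Real.sinh s - t * Real.cosh s) s := by
    rw [hf]
    exact (Real.hasDerivAt_cosh s).sub ((Real.hasDerivAt_sinh s).const_mul t)
  have hf'' (s : ℝ) : HasDerivAt (fun s => Real.sinh s - t * Real.cosh s) (f s) s := by
    rw [hf]
    exact (Real.hasDerivAt_sinh s).sub ((Real.hasDerivAt_cosh s).const_mul t)
  have hderiv : deriv f = fun s => Real.sinh s - t * Real.cosh s :=
    funext fun s => (hf' s).deriv
  have hprod (s : ℝ) : HasDerivAt (fun s => f s * (Real.sinh s - t * Real.cosh s))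
      ((deriv f s) ^ 2 + (f s) ^ 2) s := by
    refine ((hf' s).mul (hf'' s)).congr_deriv ?_
    rw [hderiv]
    ring
  have hcont : Continuous fun s => (deriv f s) ^ 2 + (f s) ^ 2 := by
    rw [hderiv, hf]
    fun_prop
  rw [intervalIntegral.integral_eq_sub_of_hasDerivAt (fun s _ => hprod s)
    (hcont.intervalIntegrable 0 d), hf]
  simp only [ht, cosh_sub_tanh_half_mul_sinh, sinh_sub_tanh_half_mul_cosh, Real.cosh_zero,
    Real.sinh_zero]
  ring
end

section
/- Let T > 0, r₀ ≥ 0, and let V, A : ℝ → ℝ be differentiable on [0,T] with A(t) ≥ 0 for all t ∈ [0,T], V(T) = 0, V'(t) ≥ (1/2)·A'(t)·√(A(t)/(4π + A(t))) for all t ∈ [0,T], and V(0) = 4π·∫₀^{r₀} sinh²(t) dt. Then A(0) ≥ 4π·sinh²(r₀). -/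
open Real

/-- The derivative `dV/dA` of enclosed volume with respect to area along the geodesic spheres
of `ℍ³`, extended evenly to negative areas so as to be continuous on `ℝ`. -/
noncomputable def sphereVolumeRate (a : ℝ) : ℝ := 1 / 2 * √(|a| / (4 * π + |a|))

lemma continuous_sphereVolumeRate : Continuous sphereVolumeRate := by
  unfold sphereVolumeRate
  refine continuous_const.mul (Continuous.sqrt (continuous_abs.div (by fun_prop) fun a => ?_))
  have := pi_pos
  positivity

lemma sphereVolumeRate_nonneg (a : ℝ) : 0 ≤ sphereVolumeRate a := by
  unfold sphereVolumeRate
  positivity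

lemma sphereVolumeRate_pos {a : ℝ} (ha : 0 < a) : 0 < sphereVolumeRate a := by
  have := pi_pos
  unfold sphereVolumeRate
  positivity

lemma sphereVolumeRate_sphere {r : ℝ} (hr : 0 ≤ r) :
    sphereVolumeRate (4 * π * sinh r ^ 2) * (8 * π * sinh r * cosh r) =
      4 * π * sinh r ^ 2 := by
  have hs : 0 ≤ sinh r := sinh_nonneg_iff.2 hr
  have hc : 0 < cosh r := cosh_pos r
  have hπ := pi_pos
  have h : |4 * π * sinh r ^ 2| / (4 * π + |4 * π * sinh r ^ 2|) = (sinh r / cosh r) ^ 2 := by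
    rw [abs_of_nonneg (by positivity), div_pow, cosh_sq]
    field_simp
    ring
  rw [sphereVolumeRate, h, sqrt_sq (by positivity)]
  field_simp
  ring

lemma integral_sphereVolumeRate_sphere {r : ℝ} (hr : 0 ≤ r) :
    ∫ a in (0 : ℝ)..4 * π * sinh r ^ 2, sphereVolumeRate a =
      4 * π * ∫ t in (0 : ℝ)..r, sinh t ^ 2 := by
  have hderiv (x : ℝ) :
      HasDerivAt (fun t => 4 * π * sinh t ^ 2) (8 * π * sinh x * cosh x) x := by
    refine (((hasDerivAt_sinh x).pow 2).const_mul (4 * π)).congr_deriv ?_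
    norm_num
    ring
  have h := intervalIntegral.integral_comp_mul_deriv (a := 0) (b := r)
    (fun x _ => hderiv x) (by fun_prop) continuous_sphereVolumeRate
  simp only [sinh_zero, ne_eq, OfNat.ofNat_ne_zero, not_false_eq_true, zero_pow, mul_zero] at h
  rw [← h, ← intervalIntegral.integral_const_mul]
  refine intervalIntegral.integral_congr fun t ht => ?_
  rw [Set.uIcc_of_le hr] at ht
  exact sphereVolumeRate_sphere ht.1

/-- Isoperimetric inequality via MCF in `ℍ³` (analytic form of Theorem 4.1):
under the flow inequalities, if the initial volume equals that of a geodesic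
ball of radius `r₀`, then the initial area is at least that of the
corresponding geodesic sphere. -/
theorem stmt_9 (T : ℝ) (hT : 0 < T) (r₀ : ℝ) (hr₀ : 0 ≤ r₀) (V A V' A' : ℝ → ℝ)
    (hA : ∀ t ∈ Set.Icc (0 : ℝ) T, 0 ≤ A t)
    (hVT : V T = 0)
    (hVderiv : ∀ t ∈ Set.Icc (0 : ℝ) T, HasDerivAt V (V' t) t)
    (hAderiv : ∀ t ∈ Set.Icc (0 : ℝ) T, HasDerivAt A (A' t) t)
    (hineq : ∀ t ∈ Set.Icc (0 : ℝ) T,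
      V' t ≥ (1 / 2) * A' t * Real.sqrt (A t / (4 * π + A t)))
    (hV0 : V 0 = 4 * π * ∫ t in (0 : ℝ)..r₀, Real.sinh t ^ 2) :
    A 0 ≥ 4 * π * Real.sinh r₀ ^ 2 := by
  have h0 : (0 : ℝ) ∈ Set.Icc 0 T := ⟨le_rfl, hT.le⟩
  have h1 : T ∈ Set.Icc 0 T := ⟨hT.le, le_rfl⟩
  set G : ℝ → ℝ := fun a => ∫ x in (0 : ℝ)..a, sphereVolumeRate x with hG
  have hint (a b : ℝ) : IntervalIntegrable sphereVolumeRate MeasureTheory.volume a b :=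
    continuous_sphereVolumeRate.intervalIntegrable a b
  have hderiv (t : ℝ) (ht : t ∈ Set.Icc 0 T) :
      HasDerivAt (fun t => V t - G (A t)) (V' t - sphereVolumeRate (A t) * A' t) t :=
    (hVderiv t ht).sub
      ((continuous_sphereVolumeRate.integral_hasStrictDerivAt 0 (A t)).hasDerivAt.comp t
        (hAderiv t ht))
  have hmono : MonotoneOn (fun t => V t - G (A t)) (Set.Icc 0 T) := by
    refine monotoneOn_of_hasDerivWithinAt_nonneg (convex_Icc 0 T)
      (fun t ht => (hderiv t ht).continuousAt.continuousWithinAt)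
      (fun t ht => (hderiv t (interior_subset ht)).hasDerivWithinAt) fun t ht => ?_
    have h := hineq t (interior_subset ht)
    rw [sphereVolumeRate, abs_of_nonneg (hA t (interior_subset ht))]
    linarith
  have hle : V 0 ≤ G (A 0) := by
    have h := hmono h0 h1 hT.le
    have hGT : 0 ≤ G (A T) :=
      intervalIntegral.integral_nonneg (hA T h1) fun x _ => sphereVolumeRate_nonneg x
    simp only [hVT] at h
    linarith
  by_contra! hlt
  have hpos := intervalIntegral.intervalIntegral_pos_of_pos_on (hint _ _)
    (fun x hx => sphereVolumeRate_pos ((hA 0 h0).trans_lt hx.1)) hlt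
  have hadd := intervalIntegral.integral_add_adjacent_intervals
    (hint 0 (A 0)) (hint (A 0) (4 * π * sinh r₀ ^ 2))
  rw [integral_sphereVolumeRate_sphere hr₀, ← hV0] at hadd
  simp only [hG] at hle
  linarith
end
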